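/- Let T be a finite tree rooted at a vertex u, let u_1, …, u_d be the children of u in T, and for each i let T_i be the subtree of T rooted at u_i. Then Γ_T(u) is the largest integer k ≥ 1 for which there exist k−1 pairwise distinct indices i_1, …, i_{k−1} ∈ {1, …, d} such that Γ_{T_{i_j}}(u_{i_j}) ≥ j for every j = 1, …, k−1. -/

import Mathlib

open SimpleGraph

variable {V : Type*}

/-- A Grundy (First-Fit) coloring of `G` with `k` colors: a proper coloring with colors
`1, …, k`, all color classes nonempty, such that every vertex of color `j` has a neighbor
of each color `i < j` (with `i ≥ 1`). -/
def IsGrundyColoring (G : SimpleGraph V) (c : V → ℕ) (k : ℕ) : Prop :=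
  (∀ v, c v ∈ Finset.Icc 1 k) ∧
  (∀ ⦃x y⦄, G.Adj x y → c x ≠ c y) ∧
  (∀ i ∈ Finset.Icc 1 k, ∃ v, c v = i) ∧
  (∀ v, ∀ i ∈ Finset.Ico 1 (c v), ∃ w, G.Adj v w ∧ c w = i)

/-- The Grundy (First-Fit) chromatic number `Γ(G)`. -/
noncomputable def grundyNumber (G : SimpleGraph V) : ℕ :=
  sSup {k | ∃ c, IsGrundyColoring G c k}

/-- `Γ_G(u)`: the largest color that `u` can receive in a Grundy coloring of `G`. -/
noncomputable def grundyAt (G : SimpleGraph V) (u : V) : ℕ :=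
  sSup {j | ∃ c k, IsGrundyColoring G c k ∧ c u = j}

/-- `v` is a cut-vertex of `G`: deleting `v` disconnects (for connected `G`, increases the
number of connected components). -/
def IsCutVertex (G : SimpleGraph V) (v : V) : Prop :=
  ¬ (G.induce {w | w ≠ v}).Connected

/-- A block of `G`: a maximal vertex set of size at least two inducing a connected subgraph
with no cut-vertex (i.e. a maximal 2-connected subgraph or a bridge with its endpoints). -/
def IsBlock (G : SimpleGraph V) (B : Set V) : Prop :=
  Maximal (fun A : Set V => 2 ≤ A.ncard ∧ (G.induce A).Connected ∧
    ∀ v ∈ A, (G.induce (A \ {v})).Connected) B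

/-- A block graph: a connected graph every block of which is complete. -/
def IsBlockGraph (G : SimpleGraph V) : Prop :=
  G.Connected ∧ ∀ B : Set V, IsBlock G B → ∀ u ∈ B, ∀ v ∈ B, u ≠ v → G.Adj u v

/-- The number of blocks of `G` containing `v` (the degree of a cut-vertex `v` in the
block-cutpoint graph). -/
noncomputable def blockDegree (G : SimpleGraph V) (v : V) : ℕ :=
  {B : Set V | IsBlock G B ∧ v ∈ B}.ncard

/-- `Δ̃(G)`: the maximum over all cut-vertices `v` of the number of blocks containing `v`. -/
noncomputable def maxCutBlockDegree (G : SimpleGraph V) : ℕ :=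
  sSup {n | ∃ v, IsCutVertex G v ∧ blockDegree G v = n}

/-- The ball `B(u, r)` of radius `r` centered at `u`. -/
def gball (G : SimpleGraph V) (u : V) (r : ℕ) : Set V :=
  {v | G.Reachable u v ∧ G.dist u v ≤ r}

lemma mem_gball_self (G : SimpleGraph V) (u : V) (r : ℕ) : u ∈ gball G u r :=
  ⟨Reachable.refl u, by simp [SimpleGraph.dist_self]⟩

/-- The degree of a vertex. -/
noncomputable def deg (G : SimpleGraph V) (v : V) : ℕ := (G.neighborSet v).ncard

/-- `Δ(u) = max {d(v) : v ∈ N(u), d(v) ≤ d(u)}`, equal to `0` if no such neighbor exists. -/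
noncomputable def maxSmallNbrDeg (G : SimpleGraph V) (u : V) : ℕ :=
  sSup {d | ∃ v, G.Adj u v ∧ deg G v ≤ deg G u ∧ deg G v = d}

/-- `Δ₂(G) = max_{u} Δ(u)`. -/
noncomputable def delta2 (G : SimpleGraph V) : ℕ :=
  sSup {d | ∃ u, maxSmallNbrDeg G u = d}

/-- The maximum number of vertices of a block of `G`. -/
noncomputable def maxBlockSize (G : SimpleGraph V) : ℕ :=
  sSup {n | ∃ B, IsBlock G B ∧ B.ncard = n}

/-- The vertex set of the subtree of `T` rooted at `w` when `T` is rooted at `u`: all vertices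
reachable from `w` by a walk avoiding `u` (the component of `T − u` containing `w`). -/
def subtreeSet (T : SimpleGraph V) (u w : V) : Set V :=
  {v | ∃ p : T.Walk w v, u ∉ p.support}


/-- A partial Grundy coloring: `0` means uncolored. -/
def PartialGrundy {W : Type*} (G : SimpleGraph W) (p : W → ℕ) : Prop :=
  (∀ ⦃x y⦄, G.Adj x y → p x ≠ 0 → p x ≠ p y) ∧
  (∀ v, ∀ i, 1 ≤ i → i < p v → ∃ w, G.Adj v w ∧ p w = i)

lemma PartialGrundy.extend {W : Type*} [Finite W] (G : SimpleGraph W) (n : ℕ) :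
    ∀ p : W → ℕ, PartialGrundy G p → {v | p v = 0}.ncard = n →
      ∃ c : W → ℕ, PartialGrundy G c ∧ (∀ v, c v ≠ 0) ∧ ∀ v, p v ≠ 0 → c v = p v := by
  classical
  induction n with
  | zero =>
    intro p hp hn
    rw [Set.ncard_eq_zero] at hn
    refine ⟨p, hp, fun v hv => ?_, fun v _ => rfl⟩
    have : v ∈ {v | p v = 0} := hv
    rw [hn] at this
    exact this
  | succ n ih =>
    intro p hp hn
    have hne : {v | p v = 0}.Nonempty := by
      rw [← Set.ncard_pos]; omega
    obtain ⟨x, hx⟩ := hne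
    have hx : p x = 0 := hx
    have hex : ∃ m, 1 ≤ m ∧ ∀ y, G.Adj x y → p y ≠ m := by
      obtain ⟨B, hB⟩ := (Set.finite_range p).bddAbove
      refine ⟨B + 1, by omega, fun y _ h => ?_⟩
      have := hB (Set.mem_range_self y)
      omega
    obtain ⟨hm1, hm2⟩ := Nat.find_spec hex
    have hmin := fun k => Nat.find_min (m := k) hex
    generalize Nat.find hex = m at hm1 hm2 hmin
    have hp' : PartialGrundy G (Function.update p x m) := by
      refine ⟨fun a b hab ha => ?_, fun v i h1 h2 => ?_⟩
      · by_cases hax : a = x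
        · subst hax
          have hb : b ≠ a := hab.ne'
          simp only [Function.update_self, Function.update_of_ne hb]
          exact (hm2 b hab).symm
        · by_cases hbx : b = x
          · subst hbx
            simp only [Function.update_self, Function.update_of_ne hax]
            exact hm2 a hab.symm
          · simp only [Function.update_of_ne hax, Function.update_of_ne hbx] at ha ⊢
            exact hp.1 hab ha
      · by_cases hvx : v = x
        · subst hvx
          simp only [Function.update_self] at h2
          have := hmin i h2
          push Not at this
          obtain ⟨y, hy, hyi⟩ := this h1
          exact ⟨y, hy, by rw [Function.update_of_ne hy.ne', hyi]⟩
        · rw [Function.update_of_ne hvx] at h2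
          obtain ⟨w, hw, hwi⟩ := hp.2 v i h1 h2
          have : w ≠ x := by rintro rfl; omega
          exact ⟨w, hw, by rw [Function.update_of_ne this, hwi]⟩
    have hcard : {v | Function.update p x m v = 0}.ncard = n := by
      have : {v | Function.update p x m v = 0} = {v | p v = 0} \ {x} := by
        ext v
        by_cases hvx : v = x
        · subst hvx; simp; omega
        · simp [hvx]
      rw [this, Set.ncard_sdiff_singleton_of_mem (show x ∈ {v | p v = 0} from hx), hn]
      rfl
    obtain ⟨c, hc, hc0, hcp⟩ := ih _ hp' hcard
    refine ⟨c, hc, hc0, fun v hv => ?_⟩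
    have hvx : v ≠ x := by rintro rfl; exact hv hx
    have := hcp v
    rw [Function.update_of_ne hvx] at this
    exact this hv

lemma grundy_bddAbove {W : Type*} [Finite W] (G : SimpleGraph W) (u : W) :
    BddAbove {j | ∃ c k, IsGrundyColoring G c k ∧ c u = j} := by
  classical
  have := Fintype.ofFinite W
  refine ⟨Fintype.card W, ?_⟩
  rintro j ⟨c, k, hc, rfl⟩
  have h1 := Finset.mem_Icc.1 (hc.1 u)
  have h2 : Finset.Icc 1 k ⊆ Finset.univ.image c := by
    intro i hi
    obtain ⟨v, hv⟩ := hc.2.2.1 i hi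
    exact Finset.mem_image.2 ⟨v, Finset.mem_univ _, hv⟩
  have h3 := (Finset.card_le_card h2).trans Finset.card_image_le
  simp only [Nat.card_Icc, Finset.card_univ] at h3
  omega

lemma PartialGrundy.le_grundyAt {W : Type*} [Finite W] {G : SimpleGraph W} {p : W → ℕ}
    (hp : PartialGrundy G p) (u : W) : p u ≤ grundyAt G u := by
  rcases Nat.eq_zero_or_pos (p u) with h | h
  · omega
  obtain ⟨c, hc, hc0, hcp⟩ := hp.extend G _ p rfl
  rw [← hcp u h.ne']
  have : Nonempty W := ⟨u⟩
  obtain ⟨x, hx⟩ := Finite.exists_max c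
  refine le_csSup (grundy_bddAbove G u) ⟨c, c x, ⟨fun v => ?_, fun a b hab => hc.1 hab (hc0 a),
    fun i hi => ?_, fun v i hi => ?_⟩, rfl⟩
  · exact Finset.mem_Icc.2 ⟨Nat.one_le_iff_ne_zero.2 (hc0 v), hx v⟩
  · rw [Finset.mem_Icc] at hi
    rcases hi.2.eq_or_lt with h | h
    · exact ⟨x, h.symm⟩
    · obtain ⟨w, _, hw⟩ := hc.2 x i hi.1 h
      exact ⟨w, hw⟩
  · rw [Finset.mem_Ico] at hi
    exact hc.2 v i hi.1 hi.2

lemma exists_partial {W : Type*} [Finite W] (G : SimpleGraph W) (u : W) (j : ℕ)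
    (hj1 : 1 ≤ j) (hj : j ≤ grundyAt G u) :
    ∃ p, PartialGrundy G p ∧ p u = j ∧ ∀ v, v ≠ u → p v < j := by
  classical
  have hne : {j | ∃ c k, IsGrundyColoring G c k ∧ c u = j}.Nonempty := by
    by_contra h
    rw [Set.not_nonempty_iff_eq_empty] at h
    rw [grundyAt, h] at hj
    simp at hj
    omega
  obtain ⟨c, k, hc, hcu⟩ := Nat.sSup_mem hne (grundy_bddAbove G u)
  have hcu : c u = grundyAt G u := hcu
  obtain ⟨h1, h2, h3, h4⟩ := hc
  refine ⟨fun v => if v = u then j else if c v < j then c v else 0, ⟨fun a b hab ha => ?_,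
    fun v i hi1 hi2 => ?_⟩, by simp, fun v hv => ?_⟩
  · have := h2 hab
    have := hab.ne
    by_cases hau : a = u <;> by_cases hbu : b = u <;> simp only [hau, hbu, if_true, if_false] at ha ⊢ <;>
      (try split_ifs at ha ⊢) <;> first | omega | simp_all
  · have hi : i < j ∧ i < c v := by
      dsimp only at hi2
      split_ifs at hi2 with h h' 
      · subst h; omega
      · omega
      · omega
    obtain ⟨w, hw, hwi⟩ := h4 v i (Finset.mem_Ico.2 ⟨hi1, hi.2⟩)
    have : w ≠ u := by rintro rfl; omega
    refine ⟨w, hw, ?_⟩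
    simp [this, hwi, hi.1]
  · simp only [hv, if_false]
    split_ifs <;> omega

lemma subtree_step {W : Type*} {T : SimpleGraph W} {u w a b : W} (ha : a ∈ subtreeSet T u w)
    (hab : T.Adj a b) (hb : b ≠ u) : b ∈ subtreeSet T u w := by
  obtain ⟨p, hp⟩ := ha
  refine ⟨p.concat hab, ?_⟩
  rw [SimpleGraph.Walk.support_concat]
  simp [hp, hb.symm]

lemma subtree_ne {W : Type*} {T : SimpleGraph W} {u w a : W} (ha : a ∈ subtreeSet T u w) :
    a ≠ u := by
  obtain ⟨p, hp⟩ := ha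
  rintro rfl
  exact hp p.end_mem_support

lemma subtree_disj {W : Type*} {T : SimpleGraph W} (hT : T.IsTree) {u x y a : W}
    (hx : T.Adj u x) (hy : T.Adj u y)
    (hax : a ∈ subtreeSet T u x) (hay : a ∈ subtreeSet T u y) : x = y := by
  classical
  by_contra hxy
  obtain ⟨p, hp⟩ := hax
  obtain ⟨q, hq⟩ := hay
  let r := (p.append q.reverse)
  have hr : u ∉ r.support := by
    simp [r, SimpleGraph.Walk.mem_support_append_iff, hp, hq]
  let s : T.Walk x y := .cons hx.symm (.cons hy .nil)
  have hs : s.IsPath := by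
    simp [s, SimpleGraph.Walk.cons_isPath_iff, hx.ne', hy.ne, hxy]
  have he := hT.IsAcyclic.path_unique ⟨s, hs⟩ r.toPath
  have h1 : u ∈ (r.toPath : T.Walk x y).support := by
    rw [← he]; simp [s]
  exact hr (SimpleGraph.Walk.support_bypass_subset r h1)

/-- For a tree `T` rooted at `u`, `Γ_T(u)` is the largest `k ≥ 1` for which
there are `k − 1` pairwise distinct children `u_{i_1}, …, u_{i_{k-1}}` of `u` with
`Γ_{T_{i_j}}(u_{i_j}) ≥ j` for every `j = 1, …, k−1`. -/
theorem statement_14 [Fintype V] (T : SimpleGraph V) (hT : T.IsTree) (u : V) :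
    IsGreatest
      {k : ℕ | 1 ≤ k ∧ ∃ f : Fin (k - 1) → V, Function.Injective f ∧
        ∀ j : Fin (k - 1), T.Adj u (f j) ∧
          ∃ hm : f j ∈ subtreeSet T u (f j),
            (j : ℕ) + 1 ≤ grundyAt (T.induce (subtreeSet T u (f j))) ⟨f j, hm⟩}
      (grundyAt T u) := by
  classical
  constructor
  · have hone : 1 ≤ grundyAt T u := by
      have : PartialGrundy T (fun v => if v = u then 1 else 0) := by
        refine ⟨fun a b hab ha => ?_, fun v i h1 h2 => ?_⟩
        · have := hab.ne
          dsimp only at ha ⊢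
          split_ifs at ha ⊢ <;> simp_all
        · dsimp only at h2
          split_ifs at h2 <;> omega
      simpa using this.le_grundyAt u
    refine ⟨hone, ?_⟩
    obtain ⟨p, hp, hpu, hpv⟩ := exists_partial T u _ hone le_rfl
    have hex : ∀ j : Fin (grundyAt T u - 1), ∃ w, T.Adj u w ∧ p w = (j : ℕ) + 1 :=
      fun j => hp.2 u _ (by omega) (by have := j.2; omega)
    choose f hf1 hf2 using hex
    refine ⟨f, fun a b hab => ?_, fun j => ⟨hf1 j, ?_⟩⟩
    · have ha := hf2 a
      rw [hab, hf2 b] at ha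
      exact Fin.ext (by omega)
    · have hm : f j ∈ subtreeSet T u (f j) := ⟨.nil, by simpa using (hf1 j).ne⟩
      refine ⟨hm, ?_⟩
      have hq : PartialGrundy (T.induce (subtreeSet T u (f j))) (fun v => p v.1) := by
        refine ⟨fun a b hab ha => hp.1 hab ha, fun v i h1 h2 => ?_⟩
        obtain ⟨w, hw, hwi⟩ := hp.2 v.1 i h1 h2
        have hlt := hpv v.1 (subtree_ne v.2)
        have hwu : w ≠ u := by
          rintro rfl
          dsimp only at h2
          omega
        exact ⟨⟨w, subtree_step v.2 hw hwu⟩, hw, hwi⟩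
      have := hq.le_grundyAt ⟨f j, hm⟩
      simpa [hf2 j] using this
  · rintro k ⟨hk, f, hinj, hf⟩
    have hex : ∀ j : Fin (k - 1), ∃ q : V → ℕ,
        q (f j) = (j : ℕ) + 1 ∧ (∀ v, q v < k) ∧
        (∀ x ∈ subtreeSet T u (f j), ∀ y ∈ subtreeSet T u (f j), T.Adj x y → q x ≠ 0 →
          q x ≠ q y) ∧
        (∀ x ∈ subtreeSet T u (f j), ∀ i, 1 ≤ i → i < q x →
          ∃ w ∈ subtreeSet T u (f j), T.Adj x w ∧ q w = i) := by
      intro j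
      obtain ⟨_, hm, hj⟩ := hf j
      obtain ⟨p, hp, hpu, hpv⟩ := exists_partial _ _ _ (by omega) hj
      have hle : ∀ v, p v ≤ (j : ℕ) + 1 := by
        intro v
        by_cases hv : v = ⟨f j, hm⟩
        · rw [hv, hpu]
        · exact (hpv v hv).le
      refine ⟨fun v => if h : v ∈ subtreeSet T u (f j) then p ⟨v, h⟩ else 0, ?_, ?_, ?_, ?_⟩
      · simp [hm, hpu]
      · intro v
        have := j.2
        dsimp only
        split_ifs with h
        · have := hle ⟨v, h⟩
          omega
        · omega
      · intro x hx y hy hxy h0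
        simp only [hx, hy, dif_pos] at h0 ⊢
        exact hp.1 (x := ⟨x, hx⟩) (y := ⟨y, hy⟩) hxy h0
      · intro x hx i h1 h2
        simp only [hx, dif_pos] at h2
        obtain ⟨w, hw, hwi⟩ := hp.2 ⟨x, hx⟩ i h1 h2
        refine ⟨w.1, w.2, hw, ?_⟩
        simpa using hwi
    choose q hq1 hq2 hq3 hq4 using hex
    let P : V → ℕ := fun v => if v = u then k else
      if h : ∃ j, v ∈ subtreeSet T u (f j) then q h.choose v else 0
    have hPu : P u = k := by simp [P]
    have hPj : ∀ j, ∀ v ∈ subtreeSet T u (f j), P v = q j v := by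
      intro j v hv
      have h : ∃ j, v ∈ subtreeSet T u (f j) := ⟨j, hv⟩
      have he : h.choose = j :=
        hinj (subtree_disj hT (hf _).1 (hf _).1 h.choose_spec hv)
      simp only [P, if_neg (subtree_ne hv), dif_pos h]
      rw [he]
    have hP0 : ∀ v, v ≠ u → P v ≠ 0 → ∃ j, v ∈ subtreeSet T u (f j) := by
      intro v hv h0
      by_contra h
      exact h0 (by simp only [P, if_neg hv, dif_neg h])
    have hPlt : ∀ v, v ≠ u → P v < k := by
      intro v hv
      by_cases h0 : P v = 0
      · omega
      · obtain ⟨j, hj⟩ := hP0 v hv h0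
        rw [hPj j v hj]
        exact hq2 j v
    have hP : PartialGrundy T P := by
      refine ⟨fun a b hab ha => ?_, fun v i h1 h2 => ?_⟩
      · by_cases hau : a = u
        · have := hPlt b (by rintro rfl; exact hab.ne hau)
          rw [hau, hPu]; omega
        · by_cases hbu : b = u
          · have := hPlt a hau
            rw [hbu, hPu]; omega
          · obtain ⟨j, hj⟩ := hP0 a hau ha
            have hb := subtree_step hj hab hbu
            rw [hPj j a hj] at ha ⊢
            rw [hPj j b hb]
            exact hq3 j a hj b hb hab ha
      · by_cases hvu : v = u
        · rw [hvu, hPu] at h2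
          let j : Fin (k - 1) := ⟨i - 1, by omega⟩
          obtain ⟨hadj, hm, _⟩ := hf j
          refine ⟨f j, hvu ▸ hadj, ?_⟩
          rw [hPj j _ hm, hq1 j]
          change i - 1 + 1 = i
          omega
        · obtain ⟨j, hj⟩ := hP0 v hvu (by omega)
          rw [hPj j v hj] at h2
          obtain ⟨w, hw, hvw, hwi⟩ := hq4 j v hj i h1 h2
          exact ⟨w, hvw, by rw [hPj j w hw, hwi]⟩
    rw [← hPu]
    exact hP.le_grundyAt u
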